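/- There exist a constant c > 0 and an integer N₀ such that for all n ≥ N₀, width(Z(n)) ≥ c · log n / log log n. -/

import Mathlib

/-- A Dyck word: entries ±1, total sum zero, all prefix sums nonnegative. -/
def IsDyck (w : List ℤ) : Prop :=
  (∀ a ∈ w, a = 1 ∨ a = -1) ∧ w.sum = 0 ∧ ∀ k, 0 ≤ (w.take k).sum

/-- Width of a finite set of naturals: the least number of intervals of
consecutive integers whose union equals the set. -/
noncomputable def setWidth (S : Finset ℕ) : ℕ :=
  sInf {k | ∃ f : Fin k → ℕ × ℕ, (S : Set ℕ) = ⋃ i, Set.Icc (f i).1 (f i).2}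

/-- A re-pairing of a word `w` over `{+1, -1}` (positions are 0-based):
a sequence of pairs (ℓᵢ, rᵢ) with w(ℓᵢ) = +1, w(rᵢ) = −1, ℓᵢ < rᵢ, such that
every position of `w` occurs in exactly one pair. -/
structure RePairing (w : List ℤ) where
  pairs : List (ℕ × ℕ)
  perm : (pairs.flatMap fun q => [q.1, q.2]).Perm (List.range w.length)
  lt : ∀ q ∈ pairs, q.1 < q.2
  plus : ∀ q ∈ pairs, w.getD q.1 0 = 1
  minus : ∀ q ∈ pairs, w.getD q.2 0 = -1

/-- The width of a re-pairing: maximum over times `t` of the width of the set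
of positions erased within the first `t` pairs. -/
noncomputable def repWidth {w : List ℤ} (p : RePairing w) : ℕ :=
  (Finset.range (p.pairs.length + 1)).sup
    fun t => setWidth ((p.pairs.take t).flatMap fun q => [q.1, q.2]).toFinset

/-- Width of a word: minimum width over all its re-pairings. -/
noncomputable def dyckWidth (w : List ℤ) : ℕ :=
  sInf {k | ∃ p : RePairing w, repWidth p = k}

/-- Z(1) = +−, Z(n+1) = + Z(n) Z(n) −. -/
def Zword : ℕ → List ℤ
  | 0 => []
  | n + 1 => 1 :: (Zword n ++ Zword n ++ [-1])

/-- Prefix sums of `w` restricted to the set `S`. -/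
def partialSum (w : ℕ → ℤ) (S : Finset ℕ) (x : ℕ) : ℤ :=
  ∑ i ∈ Finset.range x, if i ∈ S then w i else 0

/-- Prefix sums of `w`. -/
def height (w : ℕ → ℤ) (x : ℕ) : ℤ := ∑ i ∈ Finset.range x, w i

/-- The number of changes of membership in `S` between neighbours inside `[a, b)`. -/
def alternations (S : Finset ℕ) (a b : ℕ) : ℕ :=
  ((Finset.Ico a (b - 1)).filter fun i => ¬ (i ∈ S ↔ i + 1 ∈ S)).card

/-- The interval `[a, b)` is contained in `S`. -/
def Filled (S : Finset ℕ) (a b : ℕ) : Prop := ∀ i, a ≤ i → i < b → i ∈ S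

/-- The interval `[a, b)` is disjoint from `S`. -/
def Vacant (S : Finset ℕ) (a b : ℕ) : Prop := ∀ i, a ≤ i → i < b → i ∉ S

lemma height_succ (w : ℕ → ℤ) (x : ℕ) : height w (x + 1) = height w x + w x := by
  simp [height, Finset.sum_range_succ]

lemma partialSum_succ (w : ℕ → ℤ) (S : Finset ℕ) (x : ℕ) :
    partialSum w S (x + 1) = partialSum w S x + if x ∈ S then w x else 0 := by
  rw [partialSum, partialSum, Finset.sum_range_succ]

lemma Filled.mono {S T : Finset ℕ} {a b c d : ℕ} (h : Filled S a b) (hST : S ⊆ T)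
    (hac : a ≤ c) (hdb : d ≤ b) : Filled T c d :=
  fun i hi hi' => hST (h i (hac.trans hi) (hi'.trans_le hdb))

lemma Vacant.mono {S T : Finset ℕ} {a b c d : ℕ} (h : Vacant S a b) (hTS : T ⊆ S)
    (hac : a ≤ c) (hdb : d ≤ b) : Vacant T c d :=
  fun i hi hi' hiT => h i (hac.trans hi) (hi'.trans_le hdb) (hTS hiT)

lemma Filled.partialSum_eq {w : ℕ → ℤ} {S : Finset ℕ} {a b : ℕ} (hab : a ≤ b)
    (h : Filled S a b) :
    partialSum w S b - partialSum w S a = height w b - height w a := by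
  induction b, hab using Nat.le_induction with
  | base => simp
  | succ b hab ih =>
    have h1 := ih (h.mono subset_rfl le_rfl (Nat.le_succ b))
    rw [partialSum_succ, height_succ, if_pos (h b hab (Nat.lt_succ_self b))]
    linarith

lemma Vacant.partialSum_eq {w : ℕ → ℤ} {S : Finset ℕ} {a b : ℕ} (hab : a ≤ b)
    (h : Vacant S a b) : partialSum w S b = partialSum w S a := by
  induction b, hab using Nat.le_induction with
  | base => simp
  | succ b hab ih =>
    have h1 := ih (h.mono subset_rfl le_rfl (Nat.le_succ b))
    rw [partialSum_succ, if_neg (h b hab (Nat.lt_succ_self b))]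
    linarith

lemma alternations_succ (S : Finset ℕ) {a b : ℕ} (hab : a ≤ b) :
    alternations S a (b + 2) =
      alternations S a (b + 1) + if (b ∈ S ↔ b + 1 ∈ S) then 0 else 1 := by
  unfold alternations
  have : b + 2 - 1 = b + 1 := rfl
  rw [this, Nat.add_sub_cancel, ← Finset.insert_Ico_right_eq_Ico_add_one hab,
    Finset.filter_insert]
  by_cases h : (b ∈ S ↔ b + 1 ∈ S)
  · rw [if_neg (not_not.2 h), if_pos h, Nat.add_zero]
  · rw [if_pos h, if_neg h, Finset.card_insert_of_notMem (by simp)]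

lemma filled_or_vacant_of_alternations_eq_zero {S : Finset ℕ} {a b : ℕ}
    (h : alternations S a b = 0) : Filled S a b ∨ Vacant S a b := by
  have key : ∀ i, a ≤ i → i + 1 < b → (i ∈ S ↔ i + 1 ∈ S) := by
    intro i hi hib
    by_contra hne
    have : i ∈ (Finset.Ico a (b - 1)).filter fun i => ¬ (i ∈ S ↔ i + 1 ∈ S) := by
      simp only [Finset.mem_filter, Finset.mem_Ico]
      exact ⟨⟨hi, by omega⟩, hne⟩
    rw [alternations, Finset.card_eq_zero] at h
    simp [h] at this
  have all : ∀ i, a ≤ i → i < b → (a ∈ S ↔ i ∈ S) := by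
    intro i hi
    induction i, hi using Nat.le_induction with
    | base => simp
    | succ i hi ih => exact fun hib => (ih (by omega)).trans (key i hi hib)
  by_cases ha : a ∈ S
  · exact Or.inl fun i hi hib => (all i hi hib).1 ha
  · exact Or.inr fun i hi hib hiS => ha ((all i hi hib).2 hiS)

lemma Filled.alternations_eq_zero {S : Finset ℕ} {a b : ℕ} (h : Filled S a b) :
    alternations S a b = 0 := by
  rw [alternations, Finset.card_eq_zero, Finset.filter_eq_empty_iff]
  intro i hi
  rw [Finset.mem_Ico] at hi
  simp [h i hi.1 (by omega), h (i + 1) (by omega) (by omega)]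

lemma Vacant.alternations_eq_zero {S : Finset ℕ} {a b : ℕ} (h : Vacant S a b) :
    alternations S a b = 0 := by
  rw [alternations, Finset.card_eq_zero, Finset.filter_eq_empty_iff]
  intro i hi
  rw [Finset.mem_Ico] at hi
  simp [h i hi.1 (by omega), h (i + 1) (by omega) (by omega)]

lemma alternations_mono (S : Finset ℕ) {a b c d : ℕ} (hca : c ≤ a) (hbd : b ≤ d) :
    alternations S a b ≤ alternations S c d :=
  Finset.card_le_card (Finset.filter_subset_filter _
    (Finset.Ico_subset_Ico hca (Nat.sub_le_sub_right hbd 1)))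

lemma alternations_add_le (S : Finset ℕ) {a b c : ℕ} (hab : a ≤ b) (hbc : b ≤ c) :
    alternations S a b + alternations S b c ≤ alternations S a c := by
  unfold alternations
  rw [← Finset.card_union_of_disjoint]
  · apply Finset.card_le_card
    intro i
    simp only [Finset.mem_union, Finset.mem_filter, Finset.mem_Ico]
    rintro (⟨h1, h2⟩ | ⟨h1, h2⟩) <;> exact ⟨by omega, h2⟩
  · rw [Finset.disjoint_left]
    intro i
    simp only [Finset.mem_filter, Finset.mem_Ico]
    omega

/-- Summation by parts: a set with few alternations has a small sum over an interval on which
the heights vary little. -/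
lemma abs_partialSum_sub_le {w : ℕ → ℤ} (S : Finset ℕ) {a b : ℕ} {h₀ m : ℤ} (hab : a ≤ b)
    (hw : ∀ x, a ≤ x → x ≤ b → h₀ ≤ height w x ∧ height w x ≤ h₀ + m) :
    |partialSum w S b - partialSum w S a| ≤ (alternations S a b + 2) * m := by
  have hm : 0 ≤ m := by have := hw a le_rfl hab; linarith
  rcases hab.eq_or_lt with rfl | hlt
  · simp; positivity
  obtain ⟨b, rfl⟩ : ∃ c, b = c + 1 := ⟨b - 1, by omega⟩
  have key : |partialSum w S (b + 1) - partialSum w S a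
      - (if b ∈ S then height w (b + 1) - h₀ else 0)| ≤ (alternations S a (b + 1) + 1) * m := by
    have hab' : a ≤ b := by omega
    clear hab hlt
    induction b, hab' using Nat.le_induction with
    | base =>
      have h1 := hw a le_rfl (by omega)
      have h2 : alternations S a (a + 1) = 0 := by simp [alternations]
      rw [partialSum_succ, height_succ, h2]
      split_ifs
      · rw [abs_le]; constructor <;> push_cast <;> linarith
      · simpa using hm
    | succ b hab ih =>
      have h1 := hw (b + 1) (by omega) (by omega)
      have ih := ih fun x hx hx' => hw x hx (by omega)
      rw [partialSum_succ, height_succ w (b + 1), alternations_succ S hab]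
      rw [abs_le] at ih ⊢
      by_cases hb : b ∈ S <;> by_cases hb' : b + 1 ∈ S <;>
        simp only [hb, hb', if_true, if_false, iff_true, iff_false, not_true] at ih ⊢ <;>
        push_cast <;> constructor <;> linarith
  have h1 := hw (b + 1) hab le_rfl
  rw [abs_le] at key ⊢
  split_ifs at key <;> constructor <;> linarith

/-- An increasing sequence of sets of positions of a word `w`, as produced by erasing pairs
one at a time, until all positions below `N` are erased. -/
structure IsSweep (w : ℕ → ℤ) (N : ℕ) (E : ℕ → Finset ℕ) : Prop where
  zero : E 0 = ∅
  mono : Monotone E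
  card_sdiff_le (t : ℕ) : (E (t + 1) \ E t).card ≤ 2
  partialSum_mono (x : ℕ) : Monotone fun t => partialSum w (E t) x
  exhausts : ∃ T, Filled (E T) 0 N

lemma IsSweep.partialSum_nonneg {w : ℕ → ℤ} {N : ℕ} {E : ℕ → Finset ℕ} (hE : IsSweep w N E)
    (t x : ℕ) : 0 ≤ partialSum w (E t) x := by
  have := hE.partialSum_mono x (Nat.zero_le t)
  simpa [hE.zero, partialSum] using this

lemma IsSweep.partialSum_le {w : ℕ → ℤ} {N : ℕ} {E : ℕ → Finset ℕ} (hE : IsSweep w N E)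
    (t : ℕ) {x : ℕ} (hx : x ≤ N) : partialSum w (E t) x ≤ height w x := by
  obtain ⟨T, hT⟩ := hE.exhausts
  have h1 := hE.partialSum_mono x (le_max_left t T)
  have h2 := (hT.mono (hE.mono (le_max_right t T)) le_rfl hx).partialSum_eq (w := w)
    (Nat.zero_le x)
  simp only [partialSum, height, Finset.range_zero, Finset.sum_empty] at h1 h2 ⊢
  linarith

/-- Every interval of length at least three is broken up at some time, since at most two
positions are erased at once. -/
lemma IsSweep.exists_one_le_alternations {w : ℕ → ℤ} {N : ℕ} {E : ℕ → Finset ℕ}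
    (hE : IsSweep w N E) {a b : ℕ} (hab : a + 3 ≤ b) (hb : b ≤ N) :
    ∃ t, 1 ≤ alternations (E t) a b := by
  by_contra! hcon
  have key : ∀ t, Vacant (E t) a b := by
    intro t
    induction t with
    | zero => intro i _ _; simp [hE.zero]
    | succ t ih =>
      rcases filled_or_vacant_of_alternations_eq_zero
        (Nat.lt_one_iff.1 (hcon (t + 1))) with h | h
      · exfalso
        have hsub : Finset.Ico a b ⊆ E (t + 1) \ E t := by
          intro i hi
          rw [Finset.mem_Ico] at hi
          exact Finset.mem_sdiff.2 ⟨h i hi.1 hi.2, ih i hi.1 hi.2⟩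
        have := (Finset.card_le_card hsub).trans (hE.card_sdiff_le t)
        rw [Nat.card_Ico] at this
        omega
      · exact h
  obtain ⟨T, hT⟩ := hE.exhausts
  exact key T a le_rfl (by omega) (hT a (Nat.zero_le a) (by omega))

lemma exists_mem_of_one_le_alternations {S : Finset ℕ} {a b : ℕ}
    (h : 1 ≤ alternations S a b) : ∃ i, a ≤ i ∧ i < b ∧ i ∈ S := by
  by_contra! hcon
  have := Vacant.alternations_eq_zero hcon
  omega

lemma exists_notMem_of_one_le_alternations {S : Finset ℕ} {a b : ℕ}
    (h : 1 ≤ alternations S a b) : ∃ i, a ≤ i ∧ i < b ∧ i ∉ S := by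
  by_contra! hcon
  have := Filled.alternations_eq_zero hcon
  omega

/-- If an interval is filled or vacant at a time `t` and a subinterval is broken up at time `u`,
then `t` and `u` compare accordingly. -/
lemma filled_lt_or_vacant_lt {E : ℕ → Finset ℕ} (hE : Monotone E) {t u a b c d : ℕ}
    (h : Filled (E t) a b ∨ Vacant (E t) a b) (hac : a ≤ c) (hdb : d ≤ b)
    (hu : 1 ≤ alternations (E u) c d) :
    Filled (E t) a b ∧ u < t ∨ Vacant (E t) a b ∧ t < u := by
  rcases h with h | h
  · obtain ⟨i, h1, h2, h3⟩ := exists_notMem_of_one_le_alternations hu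
    refine Or.inl ⟨h, lt_of_not_ge fun htu => h3 (hE htu (h i ?_ ?_))⟩ <;> omega
  · obtain ⟨i, h1, h2, h3⟩ := exists_mem_of_one_le_alternations hu
    refine Or.inr ⟨h, lt_of_not_ge fun htu => h i ?_ ?_ (hE htu h3)⟩ <;> omega

/-- If each of several disjoint subintervals at some time carries all the alternations of
`[p, q)`, then the inner ones do so either from left to right or from right to left. -/
lemma left_to_right_or_right_to_left {E : ℕ → Finset ℕ} (hE : Monotone E) {M p q j : ℕ}
    {a b τ : ℕ → ℕ} (hj : 1 ≤ j) (hM : 3 ≤ M)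
    (hpa : ∀ c < M, p ≤ a c) (hab : ∀ c < M, a c ≤ b c) (hbq : ∀ c < M, b c ≤ q)
    (hba : ∀ c c', c < c' → c' < M → b c ≤ a c')
    (halt : ∀ t, alternations (E t) p q ≤ j)
    (hτ : ∀ c < M, j ≤ alternations (E (τ c)) (a c) (b c)) :
    (∀ c, 0 < c → c + 1 < M →
      Filled (E (τ c)) p (a c) ∧ Vacant (E (τ c)) (b c) q ∧ τ c < τ (c + 1)) ∨
    (∀ c, 0 < c → c + 1 < M →
      Vacant (E (τ c)) p (a c) ∧ Filled (E (τ c)) (b c) q ∧ τ (c + 1) < τ c) := by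
  have hone : ∀ c < M, 1 ≤ alternations (E (τ c)) (a c) (b c) :=
    fun c hc => hj.trans (hτ c hc)
  have hsplit : ∀ c < M, alternations (E (τ c)) p (a c) = 0 ∧
      alternations (E (τ c)) (b c) q = 0 := by
    intro c hc
    have h1 := alternations_add_le (E (τ c)) (hpa c hc) (hab c hc)
    have h2 := alternations_add_le (E (τ c)) ((hpa c hc).trans (hab c hc)) (hbq c hc)
    have h3 := halt (τ c)
    have h4 := hτ c hc
    omega
  have hL : ∀ c' c, c' < c → c < M → Filled (E (τ c)) p (a c) ∧ τ c' < τ c ∨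
      Vacant (E (τ c)) p (a c) ∧ τ c < τ c' := fun c' c hcc hc =>
    filled_lt_or_vacant_lt hE (filled_or_vacant_of_alternations_eq_zero (hsplit c hc).1)
      (hpa c' (by omega)) (hba c' c hcc hc) (hone c' (by omega))
  have hR : ∀ c c', c < c' → c' < M → Filled (E (τ c)) (b c) q ∧ τ c' < τ c ∨
      Vacant (E (τ c)) (b c) q ∧ τ c < τ c' := fun c c' hcc hc' =>
    filled_lt_or_vacant_lt hE
      (filled_or_vacant_of_alternations_eq_zero (hsplit c (by omega)).2)
      (hba c c' hcc hc') (hbq c' hc') (hone c' hc')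
  have hnot : ∀ c c', c < c' → c' < M → ¬ (Filled (E (τ c)) (b c) q ∧
      Vacant (E (τ c)) (b c) q) := by
    rintro c c' hcc hc' ⟨hf, hv⟩
    obtain ⟨i, h1, h2, -⟩ := exists_mem_of_one_le_alternations (hone c' hc')
    have h3 := hba c c' hcc hc'
    have h4 := hbq c' hc'
    exact hv i (by omega) (by omega) (hf i (by omega) (by omega))
  have hnot' : ∀ c' c, c' < c → c < M → ¬ (Filled (E (τ c)) p (a c) ∧
      Vacant (E (τ c)) p (a c)) := by
    rintro c' c hcc hc ⟨hf, hv⟩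
    obtain ⟨i, h1, h2, -⟩ := exists_mem_of_one_le_alternations (hone c' (by omega))
    have h3 := hba c' c hcc hc
    have h4 := hpa c' (by omega)
    exact hv i (by omega) (by omega) (hf i (by omega) (by omega))
  rcases hR 0 (M - 1) (by omega) (by omega) with ⟨h0, h0'⟩ | ⟨h0, h0'⟩
  · right
    intro c hc hcM
    have e1 := hR 0 c hc (by omega)
    have e2 := hL 0 c hc (by omega)
    have e3 := hL 0 (M - 1) (by omega) (by omega)
    have e4 := hL c (M - 1) (by omega) (by omega)
    have e5 := hR c (M - 1) (by omega) (by omega)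
    have e6 := hR c (c + 1) (by omega) hcM
    have n1 := hnot 0 (M - 1) (by omega) (by omega)
    have n2 := hnot' 0 (M - 1) (by omega) (by omega)
    have n3 := hnot c (c + 1) (by omega) (by omega)
    have f1 := (e1.resolve_right fun h => n1 ⟨h0, h.1⟩).2
    have f2 := (e2.resolve_left fun h => h.2.not_gt f1).1
    have f3 := (e3.resolve_left fun h => h.2.not_gt h0').1
    have f4 := (e4.resolve_left fun h => n2 ⟨h.1, f3⟩).2
    have f5 := (e5.resolve_right fun h => h.2.not_gt f4).1
    exact ⟨f2, f5, (e6.resolve_right fun h => n3 ⟨f5, h.1⟩).2⟩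
  · left
    intro c hc hcM
    have e1 := hR 0 c hc (by omega)
    have e2 := hL 0 c hc (by omega)
    have e3 := hL 0 (M - 1) (by omega) (by omega)
    have e4 := hL c (M - 1) (by omega) (by omega)
    have e5 := hR c (M - 1) (by omega) (by omega)
    have e6 := hR c (c + 1) (by omega) hcM
    have n1 := hnot 0 (M - 1) (by omega) (by omega)
    have n2 := hnot' 0 (M - 1) (by omega) (by omega)
    have n3 := hnot c (c + 1) (by omega) (by omega)
    have f1 := (e1.resolve_left fun h => n1 ⟨h.1, h0⟩).2
    have f2 := (e2.resolve_right fun h => h.2.not_gt f1).1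
    have f3 := (e3.resolve_right fun h => h.2.not_gt h0').1
    have f4 := (e4.resolve_right fun h => n2 ⟨f3, h.1⟩).2
    have f5 := (e5.resolve_left fun h => h.2.not_gt f4).1
    exact ⟨f2, f5, (e6.resolve_left fun h => n3 ⟨h.1, f5⟩).2⟩

lemma add_le_of_add_one_le {v : ℕ → ℤ} {M : ℕ}
    (hv : ∀ c, 0 < c → c + 2 < M → v c + 1 ≤ v (c + 1)) {c : ℕ} (hc : c + 2 < M) :
    v 1 + c ≤ v (c + 1) := by
  induction c with
  | zero => simp
  | succ c ih =>
    have := ih (by omega)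
    have := hv (c + 1) (by omega) hc
    push_cast
    linarith

/-- The number of disjoint deep intervals that are all broken up as much as the interval
containing them is bounded by the height of the left end. -/
lemma IsSweep.card_le_of_alternations {w : ℕ → ℤ} {N : ℕ} {E : ℕ → Finset ℕ}
    (hE : IsSweep w N E) {M p q j : ℕ} {a b s τ : ℕ → ℕ} {J d m B n : ℤ}
    (hj : 1 ≤ j) (hM : 3 ≤ M)
    (hpa : ∀ c < M, p ≤ a c) (hab : ∀ c < M, a c ≤ b c) (hbq : ∀ c < M, b c ≤ q)
    (hbs : ∀ c, c + 1 < M → b c ≤ s c) (hsa : ∀ c, c + 1 < M → s c ≤ a (c + 1))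
    (hqN : q ≤ N)
    (halt : ∀ t, alternations (E t) p q ≤ j) (hjB : j ≤ B)
    (hτ : ∀ c < M, j ≤ alternations (E (τ c)) (a c) (b c))
    (ha : ∀ c < M, height w (a c) = height w p + J + d)
    (hb : ∀ c < M, height w (b c) = height w p + J + d)
    (hs : ∀ c, c + 1 < M → height w (s c) = height w p + J)
    (hm : ∀ c < M, ∀ x, a c ≤ x → x ≤ b c →
      height w (a c) ≤ height w x ∧ height w x ≤ height w (a c) + m)
    (hd : (B + 2) * m + 1 ≤ d) (hn : height w p ≤ n) :
    (M : ℤ) ≤ n + 3 := by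
  have hba : ∀ c c', c < c' → c' < M → b c ≤ a c' := by
    intro c c' hcc
    induction c', hcc using Nat.le_induction with
    | base => exact fun h => (hbs c h).trans (hsa c h)
    | succ k hk ih =>
      intro h
      exact (ih (by omega)).trans ((hab k (by omega)).trans ((hbs k h).trans (hsa k h)))
  have hosc : ∀ c < M, |partialSum w (E (τ c)) (b c) - partialSum w (E (τ c)) (a c)| + 1 ≤ d := by
    intro c hc
    have h1 := abs_partialSum_sub_le (E (τ c)) (hab c hc) (hm c hc)
    have h2 : (alternations (E (τ c)) (a c) (b c) : ℤ) ≤ B :=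
      le_trans (by exact_mod_cast
        (alternations_mono _ (hpa c hc) (hbq c hc)).trans (halt _)) hjB
    have h3 : 0 ≤ m := by
      have := hm c hc (a c) le_rfl (hab c hc)
      linarith
    nlinarith
  have hv0 : ∀ c, 0 ≤ partialSum w (E (τ c)) p := fun c => hE.partialSum_nonneg _ _
  have hpN : p ≤ N := by
    have := hpa 0 (by omega)
    have := hab 0 (by omega)
    have := hbq 0 (by omega)
    omega
  have hvn : ∀ c, partialSum w (E (τ c)) p ≤ n := fun c => (hE.partialSum_le _ hpN).trans hn
  rcases left_to_right_or_right_to_left hE.mono hj hM hpa hab hbq hba halt hτ with h | h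
  · have hchain := add_le_of_add_one_le (v := fun c => partialSum w (E (τ c)) p) (M := M)
      (fun c hc hcM => ?_) (c := M - 3) (by omega)
    · have h1 := hv0 1
      have h2 := hvn (M - 3 + 1)
      have h3 : ((M - 3 : ℕ) : ℤ) = M - 3 := by omega
      simp only [h3] at hchain
      linarith
    · obtain ⟨hf, hvac, hlt⟩ := h c hc (by omega)
      obtain ⟨hf', -, -⟩ := h (c + 1) (by omega) (by omega)
      have e1 := hf.partialSum_eq (w := w) (hpa c (by omega))
      have e2 := (hvac.mono subset_rfl le_rfl ((hsa c (by omega)).trans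
        ((hab (c + 1) (by omega)).trans (hbq (c + 1) (by omega))))).partialSum_eq (w := w)
        (hbs c (by omega))
      have e3 := (hf'.mono subset_rfl le_rfl (hsa c (by omega))).partialSum_eq (w := w)
        ((hpa c (by omega)).trans ((hab c (by omega)).trans (hbs c (by omega))))
      have e4 := hE.partialSum_mono (s c) hlt.le
      have e5 := hosc c (by omega)
      have e6 := neg_abs_le (partialSum w (E (τ c)) (b c) - partialSum w (E (τ c)) (a c))
      have e7 := ha c (by omega)
      have e8 := hs c (by omega)
      simp only at e4 ⊢
      linarith
  · have hchain := add_le_of_add_one_le (v := fun c => - partialSum w (E (τ c)) p) (M := M)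
      (fun c hc hcM => ?_) (c := M - 3) (by omega)
    · have h1 := hvn 1
      have h2 := hv0 (M - 3 + 1)
      have h3 : ((M - 3 : ℕ) : ℤ) = M - 3 := by omega
      simp only [h3] at hchain
      linarith
    · obtain ⟨hvac, hf, hlt⟩ := h c hc (by omega)
      obtain ⟨hvac', -, -⟩ := h (c + 1) (by omega) (by omega)
      have e1 := hvac.partialSum_eq (w := w) (hpa c (by omega))
      have e2 := (hf.mono subset_rfl le_rfl ((hsa c (by omega)).trans
        ((hab (c + 1) (by omega)).trans (hbq (c + 1) (by omega))))).partialSum_eq (w := w)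
        (hbs c (by omega))
      have e3 := (hvac'.mono subset_rfl le_rfl (hsa c (by omega))).partialSum_eq (w := w)
        ((hpa c (by omega)).trans ((hab c (by omega)).trans (hbs c (by omega))))
      have e4 := hE.partialSum_mono (s c) hlt.le
      have e5 := hosc c (by omega)
      have e6 := le_abs_self (partialSum w (E (τ c)) (b c) - partialSum w (E (τ c)) (a c))
      have e7 := hb c (by omega)
      have e8 := hs c (by omega)
      simp only at e4 ⊢
      linarith

/-- The length of `Zword k`. -/
def zlen : ℕ → ℕ
  | 0 => 0
  | k + 1 => 2 * zlen k + 2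

/-- The word `Zword k` occurs in `w` at position `p`. -/
def Occ (w : ℕ → ℤ) : ℕ → ℕ → Prop
  | _, 0 => True
  | p, k + 1 => w p = 1 ∧ Occ w (p + 1) k ∧ Occ w (p + 1 + zlen k) k ∧
      w (p + 1 + 2 * zlen k) = -1

lemma length_Zword (k : ℕ) : (Zword k).length = zlen k := by
  induction k with
  | zero => rfl
  | succ k ih =>
    simp only [Zword, zlen, List.length_cons, List.length_append, List.length_nil, ih]
    ring

lemma occ_getD_append (u v : List ℤ) (k : ℕ) :
    Occ (fun i => (u ++ (Zword k ++ v)).getD i 0) u.length k := by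
  induction k generalizing u v with
  | zero => trivial
  | succ k ih =>
    refine ⟨by simp [Zword], ?_, ?_, ?_⟩
    · have := ih (u ++ [1]) (Zword k ++ [-1] ++ v)
      simpa [Zword, List.append_assoc] using this
    · have := ih (u ++ [1] ++ Zword k) ([-1] ++ v)
      simpa [Zword, List.append_assoc, length_Zword, Nat.add_assoc, Nat.add_comm 1] using this
    · have e : u ++ (Zword (k + 1) ++ v) = (u ++ [1] ++ Zword k ++ Zword k) ++ (-1 :: v) := by
        simp [Zword, List.append_assoc]
      simp only [e]
      have l : u.length + 1 + 2 * zlen k = (u ++ [1] ++ Zword k ++ Zword k).length := by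
        simp only [List.length_append, List.length_singleton, length_Zword]
        ring
      rw [l, List.getD_append_right _ _ _ _ le_rfl, Nat.sub_self]
      rfl

lemma occ_Zword (n : ℕ) : Occ (fun i => (Zword n).getD i 0) 0 n := by
  simpa using occ_getD_append [] [] n

lemma Occ.height_add_zlen {w : ℕ → ℤ} {p k : ℕ} (h : Occ w p k) :
    height w (p + zlen k) = height w p := by
  induction k generalizing p with
  | zero => rfl
  | succ k ih =>
    obtain ⟨h1, h2, h3, h4⟩ := h
    have e1 := ih h2
    have e2 := ih h3
    have e3 := height_succ w p
    have e4 := height_succ w (p + 1 + 2 * zlen k)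
    have l1 : p + zlen (k + 1) = p + 1 + 2 * zlen k + 1 := by rw [zlen]; ring
    have l2 : p + 1 + zlen k + zlen k = p + 1 + 2 * zlen k := by ring
    rw [l2] at e2
    rw [l1, e4, e2, e1, e3, h1, h4]
    ring

lemma Occ.height_bounds {w : ℕ → ℤ} {p k : ℕ} (h : Occ w p k) {x : ℕ} (hpx : p ≤ x)
    (hx : x ≤ p + zlen k) : height w p ≤ height w x ∧ height w x ≤ height w p + k := by
  induction k generalizing p with
  | zero =>
    obtain rfl : x = p := by simp only [zlen] at hx; omega
    simp
  | succ k ih =>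
    have hend := h.height_add_zlen
    obtain ⟨h1, h2, h3, h4⟩ := h
    have e1 := h2.height_add_zlen
    have e3 := height_succ w p
    push_cast
    rcases hpx.eq_or_lt with rfl | hlt
    · constructor <;> linarith
    rcases hx.eq_or_lt with rfl | hlt'
    · constructor <;> linarith
    rw [zlen] at hlt'
    rcases le_total x (p + 1 + zlen k) with hle | hle
    · have := ih h2 hlt hle
      constructor <;> linarith
    · have := ih h3 hle (by omega)
      constructor <;> linarith

lemma Occ.leftmost {w : ℕ → ℤ} {p k d : ℕ} (h : Occ w p (k + d)) :
    Occ w (p + d) k ∧ height w (p + d) = height w p + d ∧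
      p + d + zlen k ≤ p + zlen (k + d) := by
  induction d generalizing p with
  | zero => simpa using h
  | succ d ih =>
    obtain ⟨h1, h2, -, -⟩ := h
    obtain ⟨e1, e2, e3⟩ := ih h2
    have e4 := height_succ w p
    have l : p + 1 + d = p + (d + 1) := by ring
    rw [l] at e1 e2 e3
    refine ⟨e1, ?_, ?_⟩
    · rw [e2, e4, h1]; push_cast; ring
    · rw [← Nat.add_assoc k d 1, zlen]; omega

lemma Occ.exists_descendants {w : ℕ → ℤ} {p k J : ℕ} (h : Occ w p (k + J)) :
    ∃ Q : ℕ → ℕ, (∀ c < 2 ^ J, Occ w (Q c) k ∧ height w (Q c) = height w p + J ∧ p ≤ Q c ∧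
      Q c + zlen k ≤ p + zlen (k + J)) ∧
      ∀ c, c + 1 < 2 ^ J → Q c + zlen k ≤ Q (c + 1) := by
  induction J generalizing p with
  | zero =>
    refine ⟨fun _ => p, fun c _ => ⟨h, by simp, le_rfl, le_rfl⟩, fun c hc => ?_⟩
    simp at hc
  | succ J ih =>
    have l : zlen (k + (J + 1)) = 2 * zlen (k + J) + 2 := rfl
    obtain ⟨h1, h2, h3, -⟩ : Occ w p (k + J + 1) := h
    obtain ⟨Q₁, hQ₁, hQ₁'⟩ := ih h2
    obtain ⟨Q₂, hQ₂, hQ₂'⟩ := ih h3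
    have e1 := Occ.height_add_zlen h2
    have e3 := height_succ w p
    rw [h1] at e3
    refine ⟨fun c => if c < 2 ^ J then Q₁ c else Q₂ (c - 2 ^ J), fun c hc => ?_, fun c hc => ?_⟩
    · rw [l]
      rw [pow_succ] at hc
      dsimp only
      split_ifs with hcJ
      · obtain ⟨f1, f2, f3, f4⟩ := hQ₁ c hcJ
        exact ⟨f1, by push_cast; linarith, by omega, by omega⟩
      · obtain ⟨f1, f2, f3, f4⟩ := hQ₂ (c - 2 ^ J) (by omega)
        exact ⟨f1, by push_cast; linarith, by omega, by omega⟩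
    · rw [pow_succ] at hc
      dsimp only
      by_cases hcJ : c + 1 < 2 ^ J
      · rw [if_pos hcJ, if_pos (by omega)]
        exact hQ₁' c hcJ
      · rw [if_neg hcJ]
        split_ifs with hcJ'
        · have := (hQ₁ c hcJ').2.2.2
          have := (hQ₂ (c + 1 - 2 ^ J) (by omega)).2.2.1
          omega
        · have := hQ₂' (c - 2 ^ J) (by omega)
          rwa [show c + 1 - 2 ^ J = c - 2 ^ J + 1 by omega]

/-- If the alternations never exceed `B`, then nodes of size `2 * K ^ j` have more than `j`
alternations at some time, for `K` large compared to `B` and the logarithm of the height. -/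
lemma IsSweep.exists_lt_alternations {w : ℕ → ℤ} {N : ℕ} {E : ℕ → Finset ℕ}
    (hE : IsSweep w N E) {B J K n : ℕ} (hB : ∀ t, alternations (E t) 0 N ≤ B)
    (hJ : n + 4 ≤ 2 ^ J) (hK : J + B + 4 ≤ K)
    (hn : ∀ x ≤ N, height w x ≤ n) (j : ℕ) {p : ℕ} (hp : Occ w p (2 * K ^ j))
    (hpN : p + zlen (2 * K ^ j) ≤ N) :
    ∃ t, j < alternations (E t) p (p + zlen (2 * K ^ j)) := by
  induction j generalizing p with
  | zero => exact hE.exists_one_le_alternations (by simp [zlen]) hpN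
  | succ j ih =>
    set m := 2 * K ^ j with hmdef
    have hm : 1 ≤ m := by
      have := Nat.pow_pos (n := j) (show 0 < K by omega)
      omega
    have hsize : 2 * K ^ (j + 1) = K * m := by rw [hmdef]; ring
    obtain ⟨d, hd⟩ : ∃ d, K * m = m + d + J ∧ (B + 2) * m + 1 ≤ d := by
      have h1 : (J + B + 4) * m ≤ K * m := Nat.mul_le_mul_right m hK
      have h2 : J ≤ J * m := Nat.le_mul_of_pos_right J hm
      refine ⟨K * m - m - J, ?_, ?_⟩
      · have : (J + B + 4) * m = J * m + (B + 2) * m + m + m := by ring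
        omega
      · have : (J + B + 4) * m = J * m + (B + 2) * m + m + m := by ring
        omega
    rw [hsize, hd.1] at hp hpN ⊢
    by_contra! hcon
    obtain ⟨Q, hQ, hQ'⟩ := hp.exists_descendants
    have hleft : ∀ c < 2 ^ J, Occ w (Q c + d) m ∧ height w (Q c + d) = height w p + J + d ∧
        Q c + d + zlen m ≤ Q c + zlen (m + d) := by
      intro c hc
      obtain ⟨h1, h2, h3⟩ := (hQ c hc).1.leftmost
      exact ⟨h1, by rw [h2, (hQ c hc).2.1], h3⟩
    have hτ : ∀ c, ∃ t, c < 2 ^ J →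
        j < alternations (E t) (Q c + d) (Q c + d + zlen m) := by
      intro c
      by_cases hc : c < 2 ^ J
      · have h1 := (hQ c hc).2.2.2
        have h2 := (hleft c hc).2.2
        obtain ⟨t, ht⟩ := ih (hleft c hc).1 (by omega)
        exact ⟨t, fun _ => ht⟩
      · exact ⟨0, fun h => absurd h hc⟩
    choose τ hτ using hτ
    have hjB : j + 1 ≤ B :=
      (hτ 0 (by positivity)).trans_le <| (alternations_mono _ (Nat.zero_le _) (by
        have h1 := (hQ 0 (by positivity)).2.2.2
        have h2 := (hleft 0 (by positivity)).2.2
        omega)).trans (hB _)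
    have := hE.card_le_of_alternations (M := 2 ^ J) (p := p) (q := p + zlen (m + d + J))
      (j := j + 1) (a := fun c => Q c + d) (b := fun c => Q c + d + zlen m)
      (s := fun c => Q (c + 1)) (τ := τ) (J := J) (d := d) (m := m) (B := B) (n := n)
      (by omega) (by omega)
      (fun c hc => by have := (hQ c hc).2.2.1; omega)
      (fun c hc => by omega)
      (fun c hc => by
        have h1 := (hQ c hc).2.2.2
        have h2 := (hleft c hc).2.2
        omega)
      (fun c hc => by
        have h1 := hQ' c hc
        have h2 := (hleft c (by omega)).2.2
        omega)
      (fun c hc => by omega)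
      hpN hcon (by exact_mod_cast hjB) hτ
      (fun c hc => (hleft c hc).2.1)
      (fun c hc => by
        rw [(hleft c hc).1.height_add_zlen, (hleft c hc).2.1])
      (fun c hc => (hQ (c + 1) hc).2.1)
      (fun c hc x hx hx' => (hleft c hc).1.height_bounds hx hx')
      (by exact_mod_cast hd.2) (hn p (by omega))
    have h2 : (n : ℤ) + 4 ≤ 2 ^ J := by exact_mod_cast hJ
    push_cast at this
    linarith

lemma partialSum_insert (w : ℕ → ℤ) {S : Finset ℕ} {i : ℕ} (hi : i ∉ S) (x : ℕ) :
    partialSum w (insert i S) x = partialSum w S x + if i < x then w i else 0 := by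
  induction x with
  | zero => simp [partialSum]
  | succ x ih =>
    rw [partialSum_succ, partialSum_succ, ih]
    simp only [Finset.mem_insert]
    rcases lt_trichotomy i x with h | rfl | h
    · simp only [h.ne', false_or, h, if_true, h.trans (Nat.lt_succ_self x)]
      ring
    · simp [hi]
    · simp only [h.ne, false_or, h.not_gt, if_false, (show ¬ i < x + 1 by omega)]
      ring

/-- The positions erased within the first `t` pairs. -/
def RePairing.erased {u : List ℤ} (P : RePairing u) (t : ℕ) : Finset ℕ :=
  ((P.pairs.take t).flatMap fun q => [q.1, q.2]).toFinset

lemma RePairing.erased_succ {u : List ℤ} (P : RePairing u) {t : ℕ} (ht : t < P.pairs.length) :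
    P.erased (t + 1) = insert P.pairs[t].1 (insert P.pairs[t].2 (P.erased t)) ∧
      P.pairs[t].1 ∉ insert P.pairs[t].2 (P.erased t) ∧ P.pairs[t].2 ∉ P.erased t := by
  have htake : P.pairs.take (t + 1) = P.pairs.take t ++ [P.pairs[t]] := by simp
  refine ⟨?_, ?_⟩
  · ext i
    simp only [erased, htake, List.flatMap_append, List.mem_toFinset, List.mem_append,
      List.flatMap_singleton, List.mem_cons, List.not_mem_nil, or_false, Finset.mem_insert]
    tauto
  · have hnd : (P.pairs.flatMap fun q => [q.1, q.2]).Nodup := P.perm.nodup_iff.2 List.nodup_range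
    rw [← List.take_append_drop (t + 1) P.pairs, List.flatMap_append, htake,
      List.flatMap_append] at hnd
    have h1 := List.nodup_append.1 (List.Nodup.of_append_left hnd)
    have h2 := P.lt _ (List.getElem_mem ht)
    rw [Finset.mem_insert, not_or]
    refine ⟨⟨h2.ne, fun h => ?_⟩, fun h => ?_⟩
    · exact h1.2.2 _ (List.mem_toFinset.1 h) P.pairs[t].1 (by simp) rfl
    · exact h1.2.2 _ (List.mem_toFinset.1 h) P.pairs[t].2 (by simp) rfl

lemma RePairing.erased_succ_of_le {u : List ℤ} (P : RePairing u) {t : ℕ}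
    (ht : P.pairs.length ≤ t) : P.erased (t + 1) = P.erased t := by
  rw [erased, erased, List.take_of_length_le ht, List.take_of_length_le (by omega)]

lemma RePairing.isSweep {u : List ℤ} (P : RePairing u) :
    IsSweep (fun i => u.getD i 0) u.length P.erased where
  zero := by simp [erased]
  mono := by
    refine monotone_nat_of_le_succ fun t => ?_
    rcases lt_or_ge t P.pairs.length with ht | ht
    · rw [(P.erased_succ ht).1]
      exact (Finset.subset_insert _ _).trans (Finset.subset_insert _ _)
    · rw [P.erased_succ_of_le ht]
  card_sdiff_le t := by
    rcases lt_or_ge t P.pairs.length with ht | ht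
    · have : P.erased (t + 1) \ P.erased t ⊆ {P.pairs[t].1, P.pairs[t].2} := by
        intro i
        rw [(P.erased_succ ht).1]
        simp only [Finset.mem_sdiff, Finset.mem_insert, Finset.mem_singleton]
        tauto
      exact (Finset.card_le_card this).trans Finset.card_le_two
    · simp [P.erased_succ_of_le ht]
  partialSum_mono x := by
    refine monotone_nat_of_le_succ fun t => ?_
    rcases lt_or_ge t P.pairs.length with ht | ht
    · obtain ⟨h1, h2, h3⟩ := P.erased_succ ht
      have h4 := P.lt _ (List.getElem_mem ht)
      have h5 := P.plus _ (List.getElem_mem ht)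
      have h6 := P.minus _ (List.getElem_mem ht)
      rw [h1, partialSum_insert _ h2, partialSum_insert _ h3, h5, h6]
      split_ifs <;> omega
    · rw [P.erased_succ_of_le ht]
  exhausts := by
    refine ⟨P.pairs.length, fun i _ hi => ?_⟩
    rw [erased, List.take_length, List.mem_toFinset, P.perm.mem_iff, List.mem_range]
    exact hi

lemma alternations_le_setWidth (S : Finset ℕ) (a b : ℕ) :
    alternations S a b ≤ 2 * setWidth S := by
  have hne : {k | ∃ f : Fin k → ℕ × ℕ, (S : Set ℕ) = ⋃ i, Set.Icc (f i).1 (f i).2}.Nonempty := by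
    refine ⟨S.card, fun i => (S.equivFin.symm i, S.equivFin.symm i), ?_⟩
    ext x
    simp only [Finset.mem_coe, Set.Icc_self, Set.mem_iUnion, Set.mem_singleton_iff]
    exact ⟨fun hx => ⟨S.equivFin ⟨x, hx⟩, by simp⟩, by rintro ⟨i, rfl⟩; exact Subtype.coe_prop _⟩
  obtain ⟨f, hf⟩ := Nat.sInf_mem hne
  have hmem : ∀ x, x ∈ S ↔ ∃ i, (f i).1 ≤ x ∧ x ≤ (f i).2 := by
    exact fun x => (Set.ext_iff.1 hf x).trans (by simp)
  have hsub : (Finset.Ico a (b - 1)).filter (fun i => ¬ (i ∈ S ↔ i + 1 ∈ S)) ⊆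
      Finset.univ.image (fun i => (f i).2) ∪ Finset.univ.image (fun i => (f i).1 - 1) := by
    intro x hx
    have hx := (Finset.mem_filter.1 hx).2
    simp only [Finset.mem_union, Finset.mem_image, Finset.mem_univ, true_and]
    by_cases h : x ∈ S
    · left
      have h' : x + 1 ∉ S := by tauto
      obtain ⟨i, h1, h2⟩ := (hmem x).1 h
      refine ⟨i, le_antisymm (not_lt.1 fun h3 => h' ((hmem _).2 ⟨i, by omega, h3⟩)) h2⟩
    · right
      have h' : x + 1 ∈ S := by tauto
      obtain ⟨i, h1, h2⟩ := (hmem _).1 h'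
      refine ⟨i, ?_⟩
      have : ¬ (f i).1 ≤ x := fun h3 => h ((hmem _).2 ⟨i, h3, by omega⟩)
      omega
  refine (Finset.card_le_card hsub).trans ((Finset.card_union_le _ _).trans ?_)
  rw [two_mul]
  refine add_le_add ?_ ?_ <;>
    exact Finset.card_image_le.trans (by rw [Finset.card_univ, Fintype.card_fin]; rfl)

lemma RePairing.alternations_erased_le {u : List ℤ} (P : RePairing u) (t a b : ℕ) :
    alternations (P.erased t) a b ≤ 2 * repWidth P := by
  refine (alternations_le_setWidth _ a b).trans (Nat.mul_le_mul_left 2 ?_)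
  have h : P.erased t = P.erased (min t P.pairs.length) := by
    rw [erased, erased, ← List.take_eq_take_min]
  have hsup : repWidth P =
      (Finset.range (P.pairs.length + 1)).sup fun t => setWidth (P.erased t) := rfl
  rw [h, hsup]
  exact Finset.le_sup (f := fun t => setWidth (P.erased t))
    (Finset.mem_range.2 (Nat.lt_succ_of_le (min_le_right _ _)))

/-- The pairing of the matching letters of `Zword k`, starting at position `p`. -/
def matchingPairs : ℕ → ℕ → List (ℕ × ℕ)
  | _, 0 => []
  | p, k + 1 => (p, p + 1 + 2 * zlen k) ::
      (matchingPairs (p + 1) k ++ matchingPairs (p + 1 + zlen k) k)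

lemma matchingPairs_perm (p k : ℕ) :
    ((matchingPairs p k).flatMap fun q => [q.1, q.2]).Perm (List.range' p (zlen k)) := by
  induction k generalizing p with
  | zero => simp [matchingPairs, zlen]
  | succ k ih =>
    have e : List.range' p (zlen (k + 1)) =
        p :: (List.range' (p + 1) (zlen k) ++ List.range' (p + 1 + zlen k) (zlen k) ++
          [p + 1 + 2 * zlen k]) := by
      rw [zlen, List.range'_succ, List.range'_append_1, ← two_mul, List.range'_1_concat]
    rw [e, matchingPairs, List.flatMap_cons, List.flatMap_append]
    refine List.Perm.cons p ?_
    refine List.Perm.trans (List.Perm.cons _ ((ih _).append (ih _))) ?_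
    exact (List.perm_append_singleton _ _).symm

lemma Occ.matchingPairs {w : ℕ → ℤ} {p k : ℕ} (h : Occ w p k) :
    ∀ q ∈ matchingPairs p k, q.1 < q.2 ∧ w q.1 = 1 ∧ w q.2 = -1 := by
  induction k generalizing p with
  | zero => simp [_root_.matchingPairs]
  | succ k ih =>
    obtain ⟨h1, h2, h3, h4⟩ := h
    intro q hq
    rw [_root_.matchingPairs, List.mem_cons, List.mem_append] at hq
    rcases hq with rfl | hq | hq
    · exact ⟨by dsimp only; omega, h1, h4⟩
    · exact ih h2 q hq
    · exact ih h3 q hq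

lemma exists_repWidth_eq_dyckWidth (n : ℕ) :
    ∃ P : RePairing (Zword n), repWidth P = dyckWidth (Zword n) := by
  have h := (occ_Zword n).matchingPairs
  let P : RePairing (Zword n) :=
    { pairs := matchingPairs 0 n
      perm := by
        rw [length_Zword, List.range_eq_range']
        exact matchingPairs_perm 0 n
      lt := fun q hq => (h q hq).1
      plus := fun q hq => (h q hq).2.1
      minus := fun q hq => (h q hq).2.2 }
  exact Nat.sInf_mem (s := {k | ∃ P : RePairing (Zword n), repWidth P = k}) ⟨_, P, rfl⟩

lemma lt_of_dyckWidth_Zword {n J : ℕ} (hJ : n + 4 ≤ 2 ^ J) :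
    n < 2 * (J + 2 * dyckWidth (Zword n) + 4) ^ (2 * dyckWidth (Zword n)) := by
  obtain ⟨P, hP⟩ := exists_repWidth_eq_dyckWidth n
  set A := dyckWidth (Zword n)
  set k := 2 * (J + 2 * A + 4) ^ (2 * A) with hk
  by_contra! hlt
  obtain ⟨d, hd⟩ : ∃ d, n = k + d := ⟨n - k, by omega⟩
  have hocc := occ_Zword n
  have hocc' : Occ (fun i => (Zword n).getD i 0) 0 (k + d) := by rwa [← hd]
  obtain ⟨h1, -, h2⟩ := hocc'.leftmost
  rw [← hd, Nat.zero_add, Nat.zero_add] at h2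
  rw [Nat.zero_add] at h1
  have hB : ∀ t a b, alternations (P.erased t) a b ≤ 2 * A := fun t a b =>
    (P.alternations_erased_le t a b).trans (by rw [hP])
  obtain ⟨t, ht⟩ := P.isSweep.exists_lt_alternations (fun t => hB t _ _) hJ le_rfl
    (fun x hx => by
      have := (hocc.height_bounds (Nat.zero_le x) (by rwa [Nat.zero_add, ← length_Zword])).2
      simpa [height] using this) (2 * A) h1 (by rw [length_Zword, ← hk]; omega)
  exact ht.not_ge (hB _ _ _)

/-- width(Z(n)) = Ω(log n / log log n). -/
theorem dyckWidth_Zword_lower : ∃ (c : ℝ) (N₀ : ℕ), 0 < c ∧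
    ∀ n : ℕ, N₀ ≤ n →
      c * Real.log (n : ℝ) / Real.log (Real.log (n : ℝ))
        ≤ (dyckWidth (Zword n) : ℝ) := by
  refine ⟨1 / 8, ⌈Real.exp 6⌉₊, by norm_num, fun n hn => ?_⟩
  have hexp : Real.exp 6 ≤ n := Nat.ceil_le.1 hn
  have hn0 : (0 : ℝ) < n := (Real.exp_pos 6).trans_le hexp
  have hnpos : n ≠ 0 := by exact_mod_cast hn0.ne'
  have hL : 6 ≤ Real.log n := (Real.le_log_iff_exp_le hn0).2 hexp
  set L := Real.log n
  have hL0 : 0 < L := by linarith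
  have hl : 1 ≤ Real.log L := by
    rw [Real.le_log_iff_exp_le hL0]
    have := Real.exp_one_lt_d9
    linarith
  have hJ : n + 4 ≤ 2 ^ (Nat.log 2 n + 3) := by
    have := Nat.lt_pow_succ_log_self (b := 2) (by norm_num) n
    rw [pow_succ] at this
    rw [pow_add]
    omega
  have hmain := lt_of_dyckWidth_Zword hJ
  set A := dyckWidth (Zword n)
  rw [div_le_iff₀ (by linarith)]
  rcases le_or_gt L A with hA | hA
  · nlinarith
  have hlog : (Nat.log 2 n : ℝ) ≤ 2 * L := by
    have h1 : ((2 : ℝ) ^ Nat.log 2 n) ≤ n := by exact_mod_cast Nat.pow_log_le_self 2 hnpos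
    have h2 := Real.log_le_log (by positivity) h1
    rw [Real.log_pow] at h2
    have h3 := Real.log_two_gt_d9
    have h4 : (0 : ℝ) ≤ Nat.log 2 n := by positivity
    nlinarith
  set K : ℕ := Nat.log 2 n + 3 + 2 * A + 4 with hKdef
  have hK : (K : ℝ) ≤ L ^ 2 := by
    rw [hKdef]
    push_cast
    nlinarith
  have hKpos : (0 : ℝ) < K := by rw [hKdef]; positivity
  have hlogK : Real.log K ≤ 2 * Real.log L := by
    have := Real.log_le_log hKpos hK
    rwa [Real.log_pow] at this
  have hfin : L ≤ Real.log 2 + 2 * A * Real.log K := by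
    have h1 : (n : ℝ) ≤ 2 * (K : ℝ) ^ (2 * A) := by exact_mod_cast hmain.le
    have h2 := Real.log_le_log hn0 h1
    rw [Real.log_mul (by norm_num) (by positivity), Real.log_pow] at h2
    push_cast at h2
    exact h2
  have h2 := Real.log_two_lt_d9
  have h3 : (2 * A : ℝ) * Real.log K ≤ 2 * A * (2 * Real.log L) :=
    mul_le_mul_of_nonneg_left hlogK (by positivity)
  linarith
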